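/- Strengthened cost bound including the state (perturbed cost bound): Suppose there exists ε > 0 such that J(d) ≤ −ε ‖d‖²_{2,[0,T]} for every d ∈ L2[0,T]. Then there exists ε̃ > 0 such that for every d ∈ L2[0,T], with x the corresponding state trajectory from x(0) = 0, J(d) ≤ −ε̃ ( ‖x‖²_{2,[0,T]} + ‖d‖²_{2,[0,T]} ). -/

import Mathlib

open MeasureTheory Matrix Set

noncomputable section

/-- A function of time is piecewise continuous on `[a, b]` if it is continuous
there off a finite set of times. -/
def PiecewiseContinuousOn {E : Type*} [TopologicalSpace E] (f : ℝ → E) (a b : ℝ) : Prop :=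
  ∃ s : Finset ℝ, ContinuousOn f (Set.Icc a b \ (s : Set ℝ))

/-- Entrywise boundedness of a matrix-valued function of time on `[a, b]`. -/
def MatBoundedOn {ι κ : Type*} (f : ℝ → Matrix ι κ ℝ) (a b : ℝ) : Prop :=
  ∃ c : ℝ, ∀ t ∈ Set.Icc a b, ∀ i j, |f t i j| ≤ c

/-- Loewner (semidefinite) order `X ⪯ Y` on real symmetric matrices. -/
def loewnerLE {ι : Type*} [Fintype ι] (X Y : Matrix ι ι ℝ) : Prop :=
  (Y - X).PosSemidef

/-- Strict Loewner order `X ≺ Y` on real symmetric matrices. -/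
def loewnerLT {ι : Type*} [Fintype ι] (X Y : Matrix ι ι ℝ) : Prop :=
  (Y - X).PosDef

/-- Membership in `L2[a, b]`: measurable with integrable squared pointwise norm. -/
def MemL2 {ι : Type*} [Fintype ι] (d : ℝ → ι → ℝ) (a b : ℝ) : Prop :=
  AEStronglyMeasurable d (volume.restrict (Set.Ioc a b)) ∧
    IntervalIntegrable (fun t => d t ⬝ᵥ d t) volume a b

/-- Squared finite-horizon L2 norm `‖d‖²_{2,[a,b]} = ∫ₐᵇ d(t)ᵀ d(t) dt`. -/
def l2normSq {ι : Type*} [Fintype ι] (d : ℝ → ι → ℝ) (a b : ℝ) : ℝ :=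
  ∫ t in a..b, d t ⬝ᵥ d t

/-- Entrywise differentiability, with derivative `P'`, of a matrix-valued
function of time on `[a, b]`. -/
def HasMatDerivOn {ι κ : Type*} (P P' : ℝ → Matrix ι κ ℝ) (a b : ℝ) : Prop :=
  ∀ t ∈ Set.Icc a b, ∀ i j,
    HasDerivWithinAt (fun τ => P τ i j) (P' t i j) (Set.Icc a b) t

/-- `x` is the (absolutely continuous) state trajectory of `ẋ = A(t)x + B(t)d`
on `[0, T]` with initial condition `x 0 = x₀`, written in integral form. -/
def IsTrajectoryFrom {ι κ : Type*} [Fintype ι] [Fintype κ]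
    (A : ℝ → Matrix ι ι ℝ) (B : ℝ → Matrix ι κ ℝ) (T : ℝ) (x₀ : ι → ℝ)
    (d : ℝ → κ → ℝ) (x : ℝ → ι → ℝ) : Prop :=
  ∀ t ∈ Set.Icc (0:ℝ) T, x t = x₀ + ∫ s in (0:ℝ)..t, (A s *ᵥ x s + B s *ᵥ d s)

/-- `x` is the state trajectory of `ẋ = A(t)x + B(t)d` on `[0, T]` with `x 0 = 0`. -/
def IsTrajectory {ι κ : Type*} [Fintype ι] [Fintype κ]
    (A : ℝ → Matrix ι ι ℝ) (B : ℝ → Matrix ι κ ℝ) (T : ℝ)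
    (d : ℝ → κ → ℝ) (x : ℝ → ι → ℝ) : Prop :=
  IsTrajectoryFrom A B T 0 d x

/-- The quadratic cost `J(d)` defined by `(Q, S, R, F)` along the trajectory `x`:
`J(d) = x(T)ᵀ F x(T) + ∫₀ᵀ [x; d]ᵀ [Q, S; Sᵀ, R] [x; d] dt`. -/
def quadCost {ι κ : Type*} [Fintype ι] [Fintype κ]
    (Q : ℝ → Matrix ι ι ℝ) (S : ℝ → Matrix ι κ ℝ) (R : ℝ → Matrix κ κ ℝ)
    (F : Matrix ι ι ℝ) (T : ℝ) (d : ℝ → κ → ℝ) (x : ℝ → ι → ℝ) : ℝ :=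
  x T ⬝ᵥ (F *ᵥ x T) +
    ∫ t in (0:ℝ)..T,
      (x t ⬝ᵥ (Q t *ᵥ x t) + 2 * (x t ⬝ᵥ (S t *ᵥ d t)) + d t ⬝ᵥ (R t *ᵥ d t))

/-- Left-hand side of the Riccati differential equation / inequality:
`Ẏ + AᵀY + YA + Q − (YB+S) R⁻¹ (YB+S)ᵀ`, where `Y'` is the derivative of `Y`. -/
def rdeLHS {ι κ : Type*} [Fintype ι] [Fintype κ] [DecidableEq κ]
    (A : ℝ → Matrix ι ι ℝ) (B : ℝ → Matrix ι κ ℝ) (Q : ℝ → Matrix ι ι ℝ)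
    (S : ℝ → Matrix ι κ ℝ) (R : ℝ → Matrix κ κ ℝ)
    (Y Y' : ℝ → Matrix ι ι ℝ) (t : ℝ) : Matrix ι ι ℝ :=
  Y' t + (A t)ᵀ * Y t + Y t * A t + Q t
    - (Y t * B t + S t) * (R t)⁻¹ * (Y t * B t + S t)ᵀ

/-- Integral form of Grönwall's inequality. -/
lemma le_mul_exp_of_le_integral_add {u : ℝ → ℝ} {a D t : ℝ} (ht : 0 ≤ t) (ha : 0 < a)
    (hu : ContinuousOn u (Icc 0 t)) (h0 : ∀ s ∈ Icc 0 t, 0 ≤ u s)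
    (hle : ∀ s ∈ Icc 0 t, u s ≤ a * (∫ r in (0:ℝ)..s, u r) + D) :
    u t ≤ D * Real.exp (a * t) := by
  set w : ℝ → ℝ := IccExtend ht ((Icc 0 t).domRestrict u) with hw
  have hwc : Continuous w := (continuousOn_iff_continuous_domRestrict.mp hu).Icc_extend'
  have hwu : ∀ s ∈ Icc 0 t, w s = u s := fun s hs => by
    simp [hw, IccExtend_of_mem ht _ hs]
  have hint : ∀ s ∈ Icc 0 t, ∫ r in (0:ℝ)..s, u r = ∫ r in (0:ℝ)..s, w r := by
    intro s hs
    refine intervalIntegral.integral_congr fun r hr => ?_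
    rw [uIcc_of_le hs.1] at hr
    exact (hwu r ⟨hr.1, hr.2.trans hs.2⟩).symm
  have hderiv : ∀ s, HasDerivAt (fun s => ∫ r in (0:ℝ)..s, w r) (w s) s := fun s =>
    intervalIntegral.integral_hasDerivAt_right (hwc.intervalIntegrable _ _)
      (hwc.stronglyMeasurableAtFilter _ _) hwc.continuousAt
  have hmem : t ∈ Icc 0 t := right_mem_Icc.mpr ht
  have hgr := norm_le_gronwallBound_of_norm_deriv_right_le (f := fun s => ∫ r in (0:ℝ)..s, w r)
    (f' := w) (δ := 0) (K := a) (ε := D) (a := 0) (b := t)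
    (fun s _ => (hderiv s).continuousAt.continuousWithinAt)
    (fun s _ => (hderiv s).hasDerivWithinAt) (by simp)
    (fun s hs => by
      have hs' : s ∈ Icc 0 t := Ico_subset_Icc_self hs
      rw [hwu s hs', Real.norm_of_nonneg (h0 s hs')]
      have h1 := hle s hs'
      rw [hint s hs'] at h1
      have h2 := mul_le_mul_of_nonneg_left (le_abs_self (∫ r in (0:ℝ)..s, w r)) ha.le
      rw [Real.norm_eq_abs]
      linarith) t hmem
  rw [gronwallBound_of_K_ne_0 ha.ne', Real.norm_eq_abs, sub_zero] at hgr
  have h1 := hle t hmem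
  rw [hint t hmem] at h1
  have h2 := mul_le_mul_of_nonneg_left ((le_abs_self _).trans hgr) ha.le
  have h3 : a * (0 * Real.exp (a * t) + D / a * (Real.exp (a * t) - 1))
      = D * Real.exp (a * t) - D := by field_simp; ring
  linarith

/-- Cauchy–Schwarz against the constant function on `[0, T]`. -/
lemma sq_integral_le_mul_integral_sq {f : ℝ → ℝ} {T : ℝ} (hT : 0 < T)
    (hf : IntervalIntegrable f volume 0 T)
    (hf2 : IntervalIntegrable (fun t => f t ^ 2) volume 0 T) :
    (∫ t in (0:ℝ)..T, f t) ^ 2 ≤ T * ∫ t in (0:ℝ)..T, f t ^ 2 := by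
  set M := ∫ t in (0:ℝ)..T, f t with hM
  have h : 0 ≤ ∫ t in (0:ℝ)..T, (T * f t - M) ^ 2 :=
    intervalIntegral.integral_nonneg hT.le fun t _ => sq_nonneg _
  have he : ∫ t in (0:ℝ)..T, (T * f t - M) ^ 2
      = ∫ t in (0:ℝ)..T, (T ^ 2 * f t ^ 2 - 2 * T * M * f t + M ^ 2) := by
    congr 1; ext t; ring
  rw [he, intervalIntegral.integral_add ((hf2.const_mul _).sub (hf.const_mul _))
    intervalIntegrable_const, intervalIntegral.integral_sub (hf2.const_mul _) (hf.const_mul _),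
    intervalIntegral.integral_const_mul, intervalIntegral.integral_const_mul,
    intervalIntegral.integral_const, ← hM] at h
  simp only [sub_zero, smul_eq_mul] at h
  have h' : 0 ≤ T * (T * (∫ t in (0:ℝ)..T, f t ^ 2) - M ^ 2) := by linarith
  linarith [nonneg_of_mul_nonneg_right h' hT]

lemma sq_norm_le_dotProduct_self {ι : Type*} [Fintype ι] (v : ι → ℝ) : ‖v‖ ^ 2 ≤ v ⬝ᵥ v := by
  have h0 : 0 ≤ v ⬝ᵥ v := Finset.sum_nonneg fun i _ => mul_self_nonneg (v i)
  rw [← Real.le_sqrt (norm_nonneg _) h0, pi_norm_le_iff_of_nonneg (Real.sqrt_nonneg _)]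
  intro i
  rw [Real.norm_eq_abs]
  refine Real.abs_le_sqrt ?_
  rw [sq]
  exact Finset.single_le_sum (f := fun i => v i * v i) (fun i _ => mul_self_nonneg (v i))
    (Finset.mem_univ i)

lemma abs_dotProduct_self_le {ι : Type*} [Fintype ι] (v : ι → ℝ) :
    |v ⬝ᵥ v| ≤ Fintype.card ι * ‖v‖ ^ 2 := by
  refine (Finset.abs_sum_le_sum_abs _ _).trans ?_
  refine (Finset.sum_le_card_nsmul _ _ (‖v‖ ^ 2) fun i _ => ?_).trans_eq (by simp)
  rw [abs_mul, sq, ← Real.norm_eq_abs]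
  exact mul_self_le_mul_self (norm_nonneg _) (norm_le_pi_norm v i)

lemma norm_mulVec_le_of_abs_le {ι κ : Type*} [Fintype ι] [Fintype κ] {M : Matrix ι κ ℝ} {c : ℝ}
    (hM : ∀ i j, |M i j| ≤ c) (v : κ → ℝ) : ‖M *ᵥ v‖ ≤ Fintype.card κ * |c| * ‖v‖ := by
  rw [pi_norm_le_iff_of_nonneg (by positivity)]
  intro i
  refine (Finset.abs_sum_le_sum_abs _ _).trans ?_
  refine (Finset.sum_le_card_nsmul _ _ (|c| * ‖v‖) fun j _ => ?_).trans_eq (by simp [mul_assoc])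
  rw [abs_mul]
  exact mul_le_mul ((hM i j).trans (le_abs_self c)) (norm_le_pi_norm v j) (abs_nonneg _)
    (abs_nonneg _)

/-- The sup norm of an `L2` signal is integrable and square integrable. -/
lemma MemL2.intervalIntegrable_norm {ι : Type*} [Fintype ι] {d : ℝ → ι → ℝ} {T : ℝ}
    (hT : 0 ≤ T) (hd : MemL2 d 0 T) :
    IntervalIntegrable (fun t => ‖d t‖) volume 0 T ∧
      IntervalIntegrable (fun t => ‖d t‖ ^ 2) volume 0 T := by
  have hm : AEStronglyMeasurable (fun t => ‖d t‖) (volume.restrict (uIoc 0 T)) := by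
    rw [uIoc_of_le hT]; exact hd.1.norm
  constructor
  · refine (hd.2.add (intervalIntegrable_const (c := (1:ℝ)))).mono_fun' hm
      (Filter.Eventually.of_forall fun t => ?_)
    have := sq_norm_le_dotProduct_self (d t)
    simp only [norm_norm]
    nlinarith [sq_nonneg (‖d t‖ - 1), sq_nonneg (‖d t‖)]
  · refine hd.2.mono_fun' (hm.pow 2) (Filter.Eventually.of_forall fun t => ?_)
    simpa using sq_norm_le_dotProduct_self (d t)

/-- A trajectory from the origin is bounded by the `L1` norm of its input. At times where the
right-hand side is not integrable the integral, hence the trajectory, vanishes. -/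
lemma IsTrajectory.norm_le {ι κ : Type*} [Fintype ι] [Fintype κ]
    {A : ℝ → Matrix ι ι ℝ} {B : ℝ → Matrix ι κ ℝ} {T a b : ℝ} (ha : 0 < a) (hb : 0 ≤ b)
    (hA : ∀ t ∈ Icc 0 T, ∀ v, ‖A t *ᵥ v‖ ≤ a * ‖v‖)
    (hB : ∀ t ∈ Icc 0 T, ∀ v, ‖B t *ᵥ v‖ ≤ b * ‖v‖)
    {d : ℝ → κ → ℝ} {x : ℝ → ι → ℝ} (hd : IntervalIntegrable (fun t => ‖d t‖) volume 0 T)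
    (hx : IsTrajectory A B T d x) {t : ℝ} (ht : t ∈ Icc 0 T) :
    ‖x t‖ ≤ b * (∫ s in (0:ℝ)..T, ‖d s‖) * Real.exp (a * T) := by
  have hT : 0 ≤ T := ht.1.trans ht.2
  have hD : 0 ≤ b * ∫ s in (0:ℝ)..T, ‖d s‖ :=
    mul_nonneg hb (intervalIntegral.integral_nonneg hT fun _ _ => norm_nonneg _)
  have hx' : ∀ s ∈ Icc 0 T, x s = ∫ r in (0:ℝ)..s, (A r *ᵥ x r + B r *ᵥ d r) := fun s hs => by
    simpa using hx s hs
  by_cases hg : IntervalIntegrable (fun r => A r *ᵥ x r + B r *ᵥ d r) volume 0 t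
  swap
  · rw [hx' t ht, intervalIntegral.integral_undef hg, norm_zero]
    positivity
  have hsub : ∀ s ∈ Icc 0 t, s ∈ Icc 0 T := fun s hs => ⟨hs.1, hs.2.trans ht.2⟩
  have hxc : ContinuousOn x (Icc 0 t) := by
    have h1 : ContinuousOn (fun s => ∫ r in (0:ℝ)..s, (A r *ᵥ x r + B r *ᵥ d r)) (uIcc 0 t) :=
      intervalIntegral.continuousOn_primitive_interval' hg left_mem_uIcc
    rw [uIcc_of_le ht.1] at h1
    exact h1.congr fun s hs => hx' s (hsub s hs)
  have hle : ∀ s ∈ Icc 0 t, ‖x s‖ ≤ a * (∫ r in (0:ℝ)..s, ‖x r‖) + b * ∫ r in (0:ℝ)..T, ‖d r‖ := by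
    intro s hs
    have hsT := hsub s hs
    have hgs : IntervalIntegrable (fun r => A r *ᵥ x r + B r *ᵥ d r) volume 0 s :=
      hg.mono_set (by rw [uIcc_of_le hs.1, uIcc_of_le ht.1]; exact Icc_subset_Icc_right hs.2)
    have hds : IntervalIntegrable (fun r => ‖d r‖) volume 0 s :=
      hd.mono_set (by rw [uIcc_of_le hs.1, uIcc_of_le hT]; exact Icc_subset_Icc_right hsT.2)
    have hxs : IntervalIntegrable (fun r => ‖x r‖) volume 0 s := by
      refine ContinuousOn.intervalIntegrable ?_
      rw [uIcc_of_le hs.1]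
      exact (hxc.mono (Icc_subset_Icc_right hs.2)).norm
    calc ‖x s‖ ≤ ∫ r in (0:ℝ)..s, ‖A r *ᵥ x r + B r *ᵥ d r‖ := by
          rw [hx' s hsT]; exact intervalIntegral.norm_integral_le_integral_norm hs.1
      _ ≤ ∫ r in (0:ℝ)..s, (a * ‖x r‖ + b * ‖d r‖) := by
          refine intervalIntegral.integral_mono_on hs.1 hgs.norm
            ((hxs.const_mul a).add (hds.const_mul b)) fun r hr => ?_
          have hrT : r ∈ Icc 0 T := ⟨hr.1, hr.2.trans hsT.2⟩
          exact (norm_add_le _ _).trans (add_le_add (hA r hrT _) (hB r hrT _))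
      _ = a * (∫ r in (0:ℝ)..s, ‖x r‖) + b * ∫ r in (0:ℝ)..s, ‖d r‖ := by
          rw [intervalIntegral.integral_add (hxs.const_mul a) (hds.const_mul b),
            intervalIntegral.integral_const_mul, intervalIntegral.integral_const_mul]
      _ ≤ _ := by
          gcongr
          exact intervalIntegral.integral_mono_interval le_rfl hs.1 hsT.2
            (Filter.Eventually.of_forall fun _ => norm_nonneg _) hd
  refine (le_mul_exp_of_le_integral_add ht.1 ha hxc.norm (fun _ _ => norm_nonneg _) hle).trans ?_
  gcongr
  exact ht.2

/-- The state of a bounded system depends boundedly, in `L2`, on the input. -/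
lemma exists_l2normSq_state_le {ι κ : Type*} [Fintype ι] [Fintype κ]
    {A : ℝ → Matrix ι ι ℝ} {B : ℝ → Matrix ι κ ℝ} {T : ℝ} (hT : 0 < T)
    (hAbd : MatBoundedOn A 0 T) (hBbd : MatBoundedOn B 0 T) :
    ∃ C : ℝ, 0 ≤ C ∧ ∀ (d : ℝ → κ → ℝ) (x : ℝ → ι → ℝ), MemL2 d 0 T →
      IsTrajectory A B T d x → l2normSq x 0 T ≤ C * l2normSq d 0 T := by
  obtain ⟨cA, hcA⟩ := hAbd
  obtain ⟨cB, hcB⟩ := hBbd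
  set a : ℝ := Fintype.card ι * |cA| + 1
  set b : ℝ := Fintype.card κ * |cB|
  have ha : 0 < a := by positivity
  have hb : 0 ≤ b := by positivity
  have hA : ∀ t ∈ Icc 0 T, ∀ v, ‖A t *ᵥ v‖ ≤ a * ‖v‖ := fun t ht v =>
    (norm_mulVec_le_of_abs_le (hcA t ht) v).trans
      (mul_le_mul_of_nonneg_right (le_add_of_nonneg_right zero_le_one) (norm_nonneg v))
  have hB : ∀ t ∈ Icc 0 T, ∀ v, ‖B t *ᵥ v‖ ≤ b * ‖v‖ := fun t ht v =>
    norm_mulVec_le_of_abs_le (hcB t ht) v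
  set k : ℝ := Fintype.card ι * (b * Real.exp (a * T)) ^ 2 * T with hk
  have hk0 : 0 ≤ k := by positivity
  refine ⟨k * T, by positivity, fun d x hd hx => ?_⟩
  obtain ⟨hd1, hd2⟩ := hd.intervalIntegrable_norm hT.le
  set M := ∫ s in (0:ℝ)..T, ‖d s‖ with hM
  have hMsq : M ^ 2 ≤ T * l2normSq d 0 T := by
    refine (sq_integral_le_mul_integral_sq hT hd1 hd2).trans ?_
    gcongr
    exact intervalIntegral.integral_mono_on hT.le hd2 hd.2
      fun t _ => sq_norm_le_dotProduct_self (d t)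
  have hbound : ∀ t ∈ uIoc 0 T,
      ‖x t ⬝ᵥ x t‖ ≤ Fintype.card ι * (b * M * Real.exp (a * T)) ^ 2 := by
    intro t ht
    rw [uIoc_of_le hT.le] at ht
    refine (abs_dotProduct_self_le (x t)).trans ?_
    gcongr
    exact hx.norm_le ha hb hA hB hd1 (Ioc_subset_Icc_self ht)
  calc l2normSq x 0 T ≤ ‖l2normSq x 0 T‖ := le_abs_self _
    _ ≤ Fintype.card ι * (b * M * Real.exp (a * T)) ^ 2 * |T - 0| :=
        intervalIntegral.norm_integral_le_of_norm_le_const hbound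
    _ = k * M ^ 2 := by rw [sub_zero, abs_of_pos hT, hk]; ring
    _ ≤ k * (T * l2normSq d 0 T) := by gcongr
    _ = k * T * l2normSq d 0 T := by ring

/-- **Strengthened (perturbed) cost bound including the state.** If there is
`ε > 0` with `J(d) ≤ −ε ‖d‖²_{2,[0,T]}` for every `d ∈ L2[0,T]`, then there
is `ε̃ > 0` such that for every `d ∈ L2[0,T]`, with `x` the trajectory from
`x(0) = 0`, `J(d) ≤ −ε̃ (‖x‖²_{2,[0,T]} + ‖d‖²_{2,[0,T]})`. -/
theorem perturbed_cost_bound_including_state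
    {n m : ℕ} (T : ℝ) (hT : 0 < T)
    (A : ℝ → Matrix (Fin n) (Fin n) ℝ) (B : ℝ → Matrix (Fin n) (Fin m) ℝ)
    (Q : ℝ → Matrix (Fin n) (Fin n) ℝ) (S : ℝ → Matrix (Fin n) (Fin m) ℝ)
    (R : ℝ → Matrix (Fin m) (Fin m) ℝ) (F : Matrix (Fin n) (Fin n) ℝ)
    (hApwc : PiecewiseContinuousOn A 0 T) (hAbd : MatBoundedOn A 0 T)
    (hBpwc : PiecewiseContinuousOn B 0 T) (hBbd : MatBoundedOn B 0 T)
    (hQpwc : PiecewiseContinuousOn Q 0 T) (hQbd : MatBoundedOn Q 0 T)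
    (hSpwc : PiecewiseContinuousOn S 0 T) (hSbd : MatBoundedOn S 0 T)
    (hRpwc : PiecewiseContinuousOn R 0 T) (hRbd : MatBoundedOn R 0 T)
    (hQsym : ∀ t ∈ Set.Icc (0:ℝ) T, (Q t).IsSymm)
    (hRsym : ∀ t ∈ Set.Icc (0:ℝ) T, (R t).IsSymm)
    (hFsym : F.IsSymm)
    (ε : ℝ) (hε : 0 < ε)
    (hJ : ∀ (d : ℝ → Fin m → ℝ) (x : ℝ → Fin n → ℝ),
      MemL2 d 0 T → IsTrajectory A B T d x →
      quadCost Q S R F T d x ≤ -ε * l2normSq d 0 T) :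
    ∃ ε' > (0:ℝ), ∀ (d : ℝ → Fin m → ℝ) (x : ℝ → Fin n → ℝ),
      MemL2 d 0 T → IsTrajectory A B T d x →
      quadCost Q S R F T d x ≤ -ε' * (l2normSq x 0 T + l2normSq d 0 T) := by
  obtain ⟨C, hC, hbd⟩ := exists_l2normSq_state_le hT hAbd hBbd
  have hC1 : 0 < C + 1 := by linarith
  refine ⟨ε / (C + 1), div_pos hε hC1, fun d x hd hx => (hJ d x hd hx).trans ?_⟩
  have h1 : ε / (C + 1) * (l2normSq x 0 T + l2normSq d 0 T)
      ≤ ε / (C + 1) * ((C + 1) * l2normSq d 0 T) :=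
    mul_le_mul_of_nonneg_left (by linarith [hbd d x hd hx]) (div_pos hε hC1).le
  rw [← mul_assoc, div_mul_cancel₀ _ hC1.ne'] at h1
  linarith
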